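/- Let l ≥ 1 and set k = 2l. Let a : ℕ → ℝ satisfy a(p) > 0 for all p ≤ 2l, a(0) = 1, a(2l) = 1, and the log-concavity condition a(p−1)·a(p+1) ≤ a(p)^2 for all 1 ≤ p ≤ 2l−1. Assume a(l) ≥ a(1)^l and a(l) ≥ a(2l−1)^l. Then for every p ≤ l one has a(p) = a(1)^p and a(2l−p) = a(1)^p; in particular a(2l−1) = a(1). Moreover, if a(1) > 1, then a(l) > a(p) for every p ≤ 2l with p ≠ l. -/

import Mathlib

/-- In a positive log-concave sequence starting at `1`, consecutive ratios are at most `b 1`. -/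
theorem logConcave_succ_le_mul {n : ℕ} {b : ℕ → ℝ} (hpos : ∀ p ≤ n, 0 < b p) (h0 : b 0 = 1)
    (hconc : ∀ p, p + 2 ≤ n → b p * b (p + 2) ≤ b (p + 1) ^ 2) {p : ℕ} (hp : p + 1 ≤ n) :
    b (p + 1) ≤ b 1 * b p := by
  induction p with
  | zero => simp [h0]
  | succ p ih =>
    refine le_of_mul_le_mul_left ?_ (hpos p (by omega))
    calc b p * b (p + 2) ≤ b (p + 1) * b (p + 1) := (hconc p hp).trans_eq (sq _)
      _ ≤ b (p + 1) * (b 1 * b p) :=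
        mul_le_mul_of_nonneg_left (ih (by omega)) (hpos _ (by omega)).le
      _ = b p * (b 1 * b (p + 1)) := by ring

/-- Iterating the ratio bound for a positive log-concave sequence starting at `1`. -/
theorem logConcave_add_le_pow_mul {n : ℕ} {b : ℕ → ℝ} (hpos : ∀ p ≤ n, 0 < b p) (h0 : b 0 = 1)
    (hconc : ∀ p, p + 2 ≤ n → b p * b (p + 2) ≤ b (p + 1) ^ 2) {p j : ℕ} (hp : p + j ≤ n) :
    b (p + j) ≤ b 1 ^ j * b p := by
  induction j with
  | zero => simp
  | succ j ih =>
    calc b (p + j + 1) ≤ b 1 * b (p + j) := logConcave_succ_le_mul hpos h0 hconc hp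
      _ ≤ b 1 * (b 1 ^ j * b p) :=
        mul_le_mul_of_nonneg_left (ih (by omega)) (hpos 1 (by omega)).le
      _ = b 1 ^ (j + 1) * b p := by ring

/-- A positive log-concave sequence starting at `1` whose last term is at least `b 1 ^ n` is
geometric. -/
theorem logConcave_eq_pow {n : ℕ} {b : ℕ → ℝ} (hpos : ∀ p ≤ n, 0 < b p) (h0 : b 0 = 1)
    (hconc : ∀ p, p + 2 ≤ n → b p * b (p + 2) ≤ b (p + 1) ^ 2) (hn : b 1 ^ n ≤ b n)
    {p : ℕ} (hp : p ≤ n) : b p = b 1 ^ p := by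
  rcases Nat.eq_zero_or_pos n with rfl | hn0
  · obtain rfl : p = 0 := by omega
    simp [h0]
  obtain ⟨j, rfl⟩ := Nat.exists_eq_add_of_le hp
  apply le_antisymm
  · simpa [h0] using logConcave_add_le_pow_mul hpos h0 hconc (p := 0) (j := p) (by omega)
  · have h := hn.trans (logConcave_add_le_pow_mul hpos h0 hconc (p := p) (j := j) le_rfl)
    rw [pow_add, mul_comm] at h
    exact le_of_mul_le_mul_left h (pow_pos (hpos 1 hn0) j)

/-- Numerical core of Theorem 1.5 (hyper-Kähler case, dimension `2l`): a
positive log-concave sequence with `a 0 = a (2l) = 1`, `a l ≥ a 1 ^ l` and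
`a l ≥ a (2l-1) ^ l` satisfies `a p = a (2l - p) = a 1 ^ p` for `p ≤ l`;
in particular `a (2l-1) = a 1`, and if `a 1 > 1` then `a l` strictly
dominates all other terms. -/
theorem logConcave_hyperKahler_degrees
    (l : ℕ) (hl : 1 ≤ l) (a : ℕ → ℝ)
    (hpos : ∀ p ≤ 2 * l, 0 < a p)
    (ha0 : a 0 = 1) (hak : a (2 * l) = 1)
    (hconc : ∀ p, 1 ≤ p → p + 1 ≤ 2 * l → a (p - 1) * a (p + 1) ≤ (a p) ^ 2)
    (h1 : a l ≥ a 1 ^ l)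
    (h2 : a l ≥ a (2 * l - 1) ^ l) :
    (∀ p ≤ l, a p = a 1 ^ p ∧ a (2 * l - p) = a 1 ^ p) ∧
      a (2 * l - 1) = a 1 ∧
      (1 < a 1 → ∀ p ≤ 2 * l, p ≠ l → a p < a l) := by
  have hA : ∀ p ≤ l, a p = a 1 ^ p := fun p hp =>
    logConcave_eq_pow (n := l) (fun q hq => hpos q (by omega)) ha0
      (fun q hq => hconc (q + 1) (by omega) (by omega)) h1 hp
  have hB : ∀ p ≤ l, a (2 * l - p) = a (2 * l - 1) ^ p := fun p hp => by
    refine logConcave_eq_pow (n := l) (b := fun q => a (2 * l - q))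
      (fun q hq => hpos _ (by omega)) (by simpa using hak) (fun q hq => ?_) ?_ hp
    · have h := hconc (2 * l - (q + 1)) (by omega) (by omega)
      rw [show 2 * l - (q + 1) - 1 = 2 * l - (q + 2) by omega,
        show 2 * l - (q + 1) + 1 = 2 * l - q by omega, mul_comm] at h
      exact h
    · simpa [show 2 * l - l = l by omega] using h2
  have heq : a (2 * l - 1) = a 1 := by
    have h := hB l le_rfl
    rw [show 2 * l - l = l by omega, hA l le_rfl] at h
    exact ((pow_left_inj₀ (hpos _ (by omega)).le (hpos _ (by omega)).le (by omega)).1 h).symm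
  rw [heq] at hB
  refine ⟨fun p hp => ⟨hA p hp, hB p hp⟩, heq, fun h p hp hne => ?_⟩
  rw [hA l le_rfl]
  rcases lt_or_gt_of_ne hne with hlt | hgt
  · rw [hA p hlt.le]
    exact pow_lt_pow_right₀ h hlt
  · have hp' := hB (2 * l - p) (by omega)
    rw [show 2 * l - (2 * l - p) = p by omega] at hp'
    rw [hp']
    exact pow_lt_pow_right₀ h (by omega)
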